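/- arXiv:2408.03473 — 2 statements merged into one kernel-verified Lean document; each statement's English description precedes it below -/
import Mathlib

section
/- There exist a constant C > 0 and a Borel probability measure μ on [0,1) such that μ-almost every x fails to be b-normal for every integer base b ≥ 2 (i.e., μ is supported on the absolutely non-normal numbers), and such that |μ̂(n)| ≤ C / (log log log |n|) for all integers n with |n| ≥ C. -/
open MeasureTheory Filter Finset

/-- `e(y) = exp(-2πi y)`. -/
noncomputable def eneg (y : ℝ) : ℂ := Complex.exp (-(2 * Real.pi * Complex.I * (y : ℂ)))

/-- The `n`-th Fourier coefficient of a measure: `ν̂(n) = ∫ e(nx) dν(x)`. -/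
noncomputable def muHat (μ : Measure ℝ) (n : ℤ) : ℂ := ∫ x, eneg ((n : ℝ) * x) ∂μ

/-- A measure is Rajchman if its Fourier coefficients tend to `0` as `|n| → ∞`,
i.e. along the cofinite filter on `ℤ`. -/
def Rajchman (μ : Measure ℝ) : Prop :=
  Tendsto (fun n : ℤ => muHat μ n) cofinite (nhds 0)

/-- The `j`-th digit (for `j ≥ 1`) of the fractional part of `x` in base `b`. -/
noncomputable def digit (b : ℕ) (x : ℝ) (j : ℕ) : ℕ := ⌊Int.fract x * (b : ℝ) ^ j⌋₊ % b

/-- `x` is normal in base `b`: for every `k ≥ 1`, every block of `k` digits occurs with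
limiting frequency `b^{-k}` in the base-`b` digit expansion of the fractional part of `x`. -/
def IsNormal (b : ℕ) (x : ℝ) : Prop :=
  ∀ k : ℕ, 1 ≤ k → ∀ d : Fin k → ℕ, (∀ i, d i < b) →
    Tendsto (fun N : ℕ =>
      (((Finset.Icc 1 N).filter fun n => ∀ i : Fin k, digit b x (n + (i : ℕ)) = d i).card : ℝ) / N)
      atTop (nhds (1 / (b : ℝ) ^ k))

/-- integration over the unit interval -/
noncomputable def LL (f : ℝ → ℂ) : ℂ := ∫ x : unitInterval, f x

noncomputable def ee (n : ℤ) : ℝ → ℂ := fun x => eneg (n * x)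

lemma ee_cont (n : ℤ) : Continuous (ee n) := by
  unfold ee eneg; fun_prop

lemma eneg_add (x y : ℝ) : eneg (x + y) = eneg x * eneg y := by
  unfold eneg; rw [← Complex.exp_add]; push_cast; ring_nf

lemma ee_mul (m n : ℤ) : ee m * ee n = ee (m + n) := by
  funext x; simp only [Pi.mul_apply, ee]; rw [← eneg_add]; push_cast; ring_nf

lemma ee_mul_apply (m n : ℤ) (x : ℝ) : ee m x * ee n x = ee (m + n) x := by
  rw [← ee_mul]; rfl

lemma eneg_int (n : ℤ) : eneg n = 1 := by
  unfold eneg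
  have := Complex.exp_int_mul_two_pi_mul_I (-n)
  rw [← this]; push_cast; ring_nf

lemma eneg_norm (x : ℝ) : ‖eneg x‖ = 1 := by
  unfold eneg
  rw [Complex.norm_exp]; simp

lemma ee_zero : ee 0 = 1 := by
  funext x; simp [ee, eneg]

lemma ee_dil (n : ℤ) (q : ℕ) (x : ℝ) : ee n (q * x) = ee (n * q) x := by
  simp only [ee]; push_cast; ring_nf

lemma ee_conj (n : ℤ) (x : ℝ) : (starRingEnd ℂ) (ee n x) = ee (-n) x := by
  simp only [ee, eneg]
  rw [← Complex.exp_conj]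
  simp [Complex.conj_ofNat]

lemma LL_eq (f : ℝ → ℂ) : LL f = ∫ x in (0:ℝ)..1, f x := by
  unfold LL
  have h := integral_subtype (measurableSet_Icc (a := (0:ℝ)) (b := 1)) f
  rw [intervalIntegral.integral_of_le zero_le_one, ← integral_Icc_eq_integral_Ioc, ← h]

lemma LL_ee (n : ℤ) : LL (ee n) = if n = 0 then 1 else 0 := by
  split_ifs with h
  · subst h; rw [ee_zero]; simp [LL]
  · rw [LL_eq]
    have hc : (-(2 * Real.pi * Complex.I * n) : ℂ) ≠ 0 := by
      simp [Real.pi_ne_zero, h]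
    have : ∀ x : ℝ, ee n x = Complex.exp ((-(2 * Real.pi * Complex.I * n) : ℂ) * x) := by
      intro x; simp only [ee, eneg]; push_cast; ring_nf
    simp_rw [this]
    rw [integral_exp_mul_complex hc]
    have h1 := eneg_int n
    unfold eneg at h1
    push_cast at h1
    simp [h1]

lemma cont_int {E : Type*} [NormedAddCommGroup E] {f : ℝ → E} (hf : Continuous f)
    (μ : Measure unitInterval) [IsFiniteMeasure μ] :
    Integrable (fun x : unitInterval => f x) μ := by
  have h : Continuous (fun x : unitInterval => f x) := by fun_prop
  exact h.integrable_of_hasCompactSupport (HasCompactSupport.of_compactSpace _)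

/-- trig polynomials of degree at most `d` -/
def TP (d : ℕ) : Submodule ℂ (ℝ → ℂ) := Submodule.span ℂ (ee '' {n : ℤ | |n| ≤ d})

lemma ee_mem {n : ℤ} {d : ℕ} (h : |n| ≤ d) : ee n ∈ TP d := Submodule.subset_span ⟨n, h, rfl⟩

lemma TP_mono {d d' : ℕ} (h : d ≤ d') : TP d ≤ TP d' := by
  apply Submodule.span_mono
  apply Set.image_mono
  intro n hn
  simp only [Set.mem_ofPred_eq] at *
  have : (d : ℤ) ≤ d' := by exact_mod_cast h
  lia

lemma TP_mul {d d' : ℕ} {f g : ℝ → ℂ} (hf : f ∈ TP d) (hg : g ∈ TP d') : f * g ∈ TP (d + d') := by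
  have h := Submodule.mul_mem_mul hf hg
  unfold TP at h
  rw [Submodule.span_mul_span] at h
  refine Submodule.span_mono ?_ h
  rintro _ ⟨_, ⟨m, hm, rfl⟩, _, ⟨n, hn, rfl⟩, rfl⟩
  refine ⟨m + n, ?_, (ee_mul m n).symm⟩
  simp only [Set.mem_ofPred_eq] at *
  have := abs_add_le m n
  push_cast; lia

lemma TP_one (d : ℕ) : (1 : ℝ → ℂ) ∈ TP d := by
  rw [← ee_zero]; apply ee_mem; simp

lemma TP_dil {d : ℕ} (q : ℕ) {f : ℝ → ℂ} (hf : f ∈ TP d) : (fun x => f (q * x)) ∈ TP (q * d) := by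
  unfold TP at hf
  induction hf using Submodule.span_induction with
  | mem f h =>
    obtain ⟨n, hn, rfl⟩ := h
    simp_rw [ee_dil]
    apply ee_mem
    simp only [Set.mem_ofPred_eq] at hn
    rw [abs_mul, mul_comm]
    push_cast
    simp only [Nat.abs_cast]
    gcongr
  | zero => exact Submodule.zero_mem _
  | add f g _ _ hf hg => exact Submodule.add_mem _ hf hg
  | smul c f _ hf => exact Submodule.smul_mem _ c hf

lemma TP_cont {d : ℕ} {f : ℝ → ℂ} (hf : f ∈ TP d) : Continuous f := by
  unfold TP at hf
  induction hf using Submodule.span_induction with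
  | mem f h =>
    obtain ⟨n, hn, rfl⟩ := h
    exact ee_cont n
  | zero => exact continuous_const
  | add f g _ _ hf hg => exact hf.add hg
  | smul c f _ hf => exact hf.const_smul c

lemma LL_add {f g : ℝ → ℂ} (hf : Continuous f) (hg : Continuous g) : LL (f + g) = LL f + LL g := by
  unfold LL
  exact integral_add (cont_int hf _) (cont_int hg _)

lemma LL_smul (c : ℂ) (f : ℝ → ℂ) : LL (c • f) = c * LL f := by
  unfold LL
  exact integral_const_mul c _

lemma LL_zero : LL 0 = 0 := by simp [LL]

/-- key factorization -/
lemma LL_fact {d d' q : ℕ} (hd : d < q) {f g : ℝ → ℂ} (hf : f ∈ TP d) (hg : g ∈ TP d') :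
    LL (f * fun x => g (q * x)) = LL f * LL g := by
  have hgc : Continuous (fun x : ℝ => g (q * x)) := (TP_cont hg).comp (by fun_prop)
  unfold TP at hf
  induction hf using Submodule.span_induction with
  | mem f h =>
    obtain ⟨n, hn, rfl⟩ := h
    clear hgc
    unfold TP at hg
    induction hg using Submodule.span_induction with
    | mem g h =>
      obtain ⟨k, hk, rfl⟩ := h
      simp_rw [ee_dil]
      rw [show (ee n * fun x => ee (k * q) x) = ee (n + k * q) from ee_mul _ _]
      simp only [LL_ee]
      simp only [Set.mem_ofPred_eq] at hn
      by_cases hk0 : k = 0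
      · subst hk0; simp
      · have : n + k * q ≠ 0 := by
          intro h
          have h1 : n = - (k * q) := by linarith
          rw [h1, abs_neg, abs_mul] at hn
          simp only [Nat.abs_cast] at hn
          have h2 : 1 ≤ |k| := Int.one_le_abs hk0
          have h3 : (d : ℤ) < q := by exact_mod_cast hd
          nlinarith
        simp [this, hk0]
    | zero =>
      have : (ee n * fun x : ℝ => (0 : ℝ → ℂ) (q * x)) = 0 := by funext x; simp
      rw [this]; simp [LL_zero]
    | add f g hf' hg' hf hg =>
      have e : (ee n * fun x : ℝ => (f + g) (q * x))
        = (ee n * fun x : ℝ => f (q * x)) + (ee n * fun x : ℝ => g (q * x)) := by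
        funext x; simp [mul_add]
      have cf : Continuous (fun x : ℝ => f (q * x)) := (TP_cont hf').comp (by fun_prop)
      have cg : Continuous (fun x : ℝ => g (q * x)) := (TP_cont hg').comp (by fun_prop)
      rw [e, LL_add ((ee_cont n).mul cf) ((ee_cont n).mul cg), hf, hg,
        LL_add (TP_cont hf') (TP_cont hg')]
      ring
    | smul c f _ hf =>
      have e : (ee n * fun x : ℝ => (c • f) (q * x)) = c • (ee n * fun x : ℝ => f (q * x)) := by
        funext x; simp; ring
      rw [e, LL_smul, hf, LL_smul]; ring
  | zero => simp [LL_zero]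
  | add f g hf' hg' hf hg =>
    rw [add_mul, LL_add ((TP_cont hf').mul hgc) ((TP_cont hg').mul hgc), hf, hg,
      LL_add (TP_cont hf') (TP_cont hg')]
    ring
  | smul c f _ hf =>
    rw [smul_mul_assoc, LL_smul, hf, LL_smul]; ring

lemma LL_high {d : ℕ} {n : ℤ} (hn : (d : ℤ) < |n|) {f : ℝ → ℂ} (hf : f ∈ TP d) :
    LL (ee n * f) = 0 := by
  unfold TP at hf
  induction hf using Submodule.span_induction with
  | mem f h =>
    obtain ⟨k, hk, rfl⟩ := h
    rw [ee_mul, LL_ee, if_neg]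
    intro h
    simp only [Set.mem_ofPred_eq] at hk
    have : n = -k := by linarith
    rw [this, abs_neg] at hn
    lia
  | zero => simp [LL_zero]
  | add f g hf' hg' hf hg =>
    rw [mul_add, LL_add ((ee_cont n).mul (TP_cont hf')) ((ee_cont n).mul (TP_cont hg')), hf, hg]
    simp
  | smul c f _ hf =>
    rw [mul_smul_comm, LL_smul, hf]; simp

/-- Dirichlet sum -/
noncomputable def SS (D : ℕ) (x : ℝ) : ℂ := ∑ j ∈ range D, ee j x

lemma SS_cont (D : ℕ) : Continuous (SS D) := by
  unfold SS
  exact continuous_finsetSum _ fun j _ => ee_cont j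

lemma SS_sq (D : ℕ) (x : ℝ) :
    ((‖SS D x‖ ^ 2 : ℝ) : ℂ) = ∑ i ∈ range D, ∑ j ∈ range D, ee ((i : ℤ) - j) x := by
  push_cast
  rw [← Complex.mul_conj']
  unfold SS
  rw [map_sum, Finset.sum_mul_sum]
  simp_rw [ee_conj, ee_mul_apply]
  rfl

lemma SS_TP (D : ℕ) : (fun x => ((‖SS D x‖ ^ 2 : ℝ) : ℂ)) ∈ TP D := by
  have : (fun x => ((‖SS D x‖ ^ 2 : ℝ) : ℂ)) = ∑ i ∈ range D, ∑ j ∈ range D, ee ((i : ℤ) - j) := by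
    funext x; rw [SS_sq]; simp
  rw [this]
  refine Submodule.sum_mem _ fun i hi => Submodule.sum_mem _ fun j hj => ee_mem ?_
  rw [Finset.mem_range] at hi hj
  rw [abs_le]; constructor <;> lia

lemma SS_L2 (D : ℕ) : ∫ x : unitInterval, ‖SS D x‖ ^ 2 = D := by
  have : ((∫ x : unitInterval, ‖SS D x‖ ^ 2 : ℝ) : ℂ) = (D : ℂ) := by
    rw [← integral_complex_ofReal]
    simp_rw [SS_sq]
    rw [integral_finsetSum _ (fun i _ => integrable_finsetSum _ (fun j _ => cont_int (ee_cont _) _))]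
    rw [Finset.sum_congr rfl (fun i hi => integral_finsetSum _ (fun j _ => cont_int (ee_cont _) _))]
    change ∑ i ∈ range D, ∑ j ∈ range D, LL (ee ((i : ℤ) - j)) = D
    simp_rw [LL_ee, sub_eq_zero, Nat.cast_inj]
    have : ∀ i ∈ range D, (∑ j ∈ range D, if i = j then (1 : ℂ) else 0) = 1 := by
      intro i hi
      rw [Finset.sum_ite_eq, if_pos hi]
    rw [Finset.sum_congr rfl this]
    simp
  exact_mod_cast this

lemma SS_le (D : ℕ) (x : ℝ) : ‖SS D x‖ ≤ D := by
  unfold SS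
  refine (norm_sum_le _ _).trans ?_
  simp [ee, eneg_norm]

lemma SS_lower {D : ℕ} {x : ℝ} (h0 : 0 ≤ x) (hx : x * (6 * D) ≤ 1) : (D : ℝ) / 2 ≤ ‖SS D x‖ := by
  refine le_trans ?_ (Complex.re_le_norm _)
  unfold SS
  rw [Complex.re_sum]
  have : (D : ℝ) / 2 = ∑ j ∈ range D, (1 / 2 : ℝ) := by simp; ring
  rw [this]
  refine Finset.sum_le_sum fun j hj => ?_
  rw [Finset.mem_range] at hj
  have e : (ee j x).re = Real.cos (2 * Real.pi * (j * x)) := by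
    simp only [ee, eneg]
    rw [← Real.cos_neg, ← Complex.exp_ofReal_mul_I_re]
    congr 2
    push_cast; ring
  rw [e, ← Real.cos_pi_div_three]
  have hj' : (j : ℝ) ≤ D := by exact_mod_cast hj.le
  have : (j : ℝ) * x ≤ 1 / 6 := by nlinarith
  apply Real.cos_le_cos_of_nonneg_of_le_pi
  · have := Real.pi_pos; positivity
  · linarith [Real.pi_pos]
  · nlinarith [Real.pi_pos]

lemma SS_L4 {D : ℕ} (hD : 1 ≤ D) : (D : ℝ) ^ 3 / 96 ≤ ∫ x : unitInterval, ‖SS D x‖ ^ 4 := by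
  have hD' : (1 : ℝ) ≤ D := by exact_mod_cast hD
  have h := mul_meas_ge_le_integral_of_nonneg (μ := (volume : Measure unitInterval))
    (f := fun x : unitInterval => ‖SS D x‖ ^ 4) (Eventually.of_forall fun x => by positivity)
    (cont_int (f := fun x => ‖SS D x‖ ^ 4) ((SS_cont D).norm.pow 4) _) (((D : ℝ) / 2) ^ 4)
  refine le_trans ?_ h
  let c : unitInterval := ⟨1 / (6 * D), by positivity, by rw [div_le_one (by positivity)]; linarith⟩
  have hsub : Set.Iic c ⊆ {x : unitInterval | ((D : ℝ) / 2) ^ 4 ≤ ‖SS D x‖ ^ 4} := by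
    intro x hx
    have hx' : (x : ℝ) ≤ 1 / (6 * D) := hx
    simp only [Set.mem_ofPred_eq]
    have := SS_lower (D := D) x.2.1 (by rwa [le_div_iff₀ (by positivity)] at hx')
    gcongr
  have h2 := measureReal_mono (μ := (volume : Measure unitInterval)) hsub
  have h3 : (volume : Measure unitInterval).real (Set.Iic c) = 1 / (6 * D) := by
    rw [Measure.real, unitInterval.volume_Iic, ENNReal.toReal_ofReal (by positivity)]
  rw [h3] at h2
  calc (D : ℝ) ^ 3 / 96 = ((D : ℝ) / 2) ^ 4 * (1 / (6 * D)) := by field_simp; norm_num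
    _ ≤ _ := by gcongr

lemma SS_upper (D : ℕ) (x : ℝ) : ‖SS D x‖ * (2 * |x - round x|) ≤ 1 := by
  have e1 : SS D x = ∑ j ∈ range D, (eneg x) ^ j := by
    unfold SS
    refine Finset.sum_congr rfl fun j _ => ?_
    simp only [ee, eneg]
    rw [← Complex.exp_nat_mul]; push_cast; ring_nf
  have e2 : SS D x * (eneg x - 1) = (eneg x) ^ D - 1 := by rw [e1, geom_sum_mul]
  have e3 : ‖SS D x‖ * ‖eneg x - 1‖ ≤ 2 := by
    rw [← norm_mul, e2]
    refine (norm_sub_le _ _).trans ?_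
    rw [norm_pow, eneg_norm]; norm_num
  have e4 : 4 * |x - round x| ≤ ‖eneg x - 1‖ := by
    have : eneg x = eneg (x - round x) := by
      conv_lhs => rw [← sub_add_cancel x (round x : ℝ), eneg_add, eneg_int, mul_one]
    rw [this]
    set t := x - round x
    have ht : |t| ≤ 1 / 2 := abs_sub_round x
    have e5 : eneg t = Complex.exp (Complex.I * ((-(2 * Real.pi * t) : ℝ) : ℂ)) := by
      unfold eneg; push_cast; ring_nf
    rw [e5, Complex.norm_exp_I_mul_ofReal_sub_one]
    have e6 : |-(2 * Real.pi * t) / 2| = Real.pi * |t| := by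
      rw [show -(2 * Real.pi * t) / 2 = - (Real.pi * t) by ring, abs_neg, abs_mul,
        abs_of_pos Real.pi_pos]
    have := Real.mul_abs_le_abs_sin (x := -(2 * Real.pi * t) / 2)
      (by rw [e6]; nlinarith [Real.pi_pos])
    rw [e6] at this
    rw [norm_mul, Real.norm_eq_abs, Real.norm_eq_abs]
    have h7 : 2 / Real.pi * (Real.pi * |t|) = 2 * |t| := by
      field_simp
    rw [h7] at this
    norm_num
    linarith
  have := norm_nonneg (SS D x)
  nlinarith

noncomputable def FF (q : ℕ) (x : ℝ) : ℝ := ‖SS (q ^ 2) x‖ ^ 2 / (q : ℝ) ^ 2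
noncomputable def phi (q : ℕ) (x : ℝ) : ℝ := ‖SS (q ^ 2) x‖ ^ 2 / (q : ℝ) ^ 4
noncomputable def hh (q : ℕ) (a : ℝ) (x : ℝ) : ℝ := (1 - a) + a * FF q x

lemma FF_cont (q : ℕ) : Continuous (FF q) := by
  unfold FF; exact ((SS_cont _).norm.pow 2).div_const _
lemma phi_cont (q : ℕ) : Continuous (phi q) := by
  unfold phi; exact ((SS_cont _).norm.pow 2).div_const _
lemma hh_cont (q : ℕ) (a : ℝ) : Continuous (hh q a) := by
  unfold hh; exact continuous_const.add (continuous_const.mul (FF_cont q))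
lemma FF_nonneg (q : ℕ) (x : ℝ) : 0 ≤ FF q x := by unfold FF; positivity
lemma phi_nonneg (q : ℕ) (x : ℝ) : 0 ≤ phi q x := by unfold phi; positivity
lemma phi_le (q : ℕ) (x : ℝ) : phi q x ≤ 1 := by
  unfold phi
  apply div_le_one_of_le₀ _ (by positivity)
  have := SS_le (q ^ 2) x
  push_cast at this
  calc _ ≤ ((q : ℝ) ^ 2) ^ 2 := by gcongr
    _ = _ := by ring
lemma hh_nonneg (q : ℕ) {a : ℝ} (h0 : 0 ≤ a) (h1 : a ≤ 1) (x : ℝ) : 0 ≤ hh q a x := by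
  unfold hh
  have := mul_nonneg h0 (FF_nonneg q x)
  linarith

lemma FF_int {q : ℕ} (hq : 1 ≤ q) : ∫ x : unitInterval, FF q x = 1 := by
  unfold FF
  rw [integral_div, SS_L2]
  have : (q : ℝ) ≠ 0 := by positivity
  push_cast; field_simp

lemma hh_int {q : ℕ} (hq : 1 ≤ q) (a : ℝ) : ∫ x : unitInterval, hh q a x = 1 := by
  unfold hh
  rw [integral_add (integrable_const _) ((cont_int (FF_cont q) _).const_mul a),
    integral_const_mul, FF_int hq]
  simp

lemma Fphi_int {q : ℕ} (hq : 1 ≤ q) : 1 / 96 ≤ ∫ x : unitInterval, FF q x * phi q x := by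
  have : ∀ x : unitInterval, FF q x * phi q x = ‖SS (q ^ 2) x‖ ^ 4 / (q : ℝ) ^ 6 := by
    intro x; unfold FF phi; have : (q : ℝ) ≠ 0 := by positivity
    field_simp
  simp_rw [this]
  rw [integral_div]
  have h := SS_L4 (D := q ^ 2) (Nat.one_le_pow _ _ hq)
  rw [le_div_iff₀ (by positivity)]
  push_cast at h
  refine le_trans (le_of_eq ?_) h
  ring

lemma hphi_int {q : ℕ} (hq : 1 ≤ q) {a : ℝ} (h0 : 0 ≤ a) (h1 : a ≤ 1) :
    ∫ x : unitInterval, hh q a x * (1 - phi q x) ≤ 1 - a / 96 := by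
  have hc : Continuous (fun x => FF q x * phi q x) := (FF_cont q).mul (phi_cont q)
  have h : ∫ x : unitInterval, hh q a x * (1 - phi q x)
      ≤ ∫ x : unitInterval, (hh q a x - a * (FF q x * phi q x)) := by
    apply integral_mono
    · exact cont_int (f := fun x => hh q a x * (1 - phi q x))
        ((hh_cont q a).mul (continuous_const.sub (phi_cont q))) _
    · exact cont_int (f := fun x => hh q a x - a * (FF q x * phi q x))
        ((hh_cont q a).sub (continuous_const.mul hc)) _
    · intro x
      have := phi_nonneg q x
      simp only
      unfold hh
      nlinarith
  refine h.trans ?_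
  rw [integral_sub (cont_int (hh_cont q a) _) ((cont_int hc _).const_mul a),
    integral_const_mul, hh_int hq]
  have := Fphi_int hq
  nlinarith

lemma FF_TP (q : ℕ) : (fun x => (FF q x : ℂ)) ∈ TP (q ^ 2) := by
  have : (fun x => (FF q x : ℂ)) = ((1 / (q : ℂ) ^ 2)) • (fun x => ((‖SS (q ^ 2) x‖ ^ 2 : ℝ) : ℂ)) := by
    funext x; simp [FF]; ring
  rw [this]
  exact Submodule.smul_mem _ _ (SS_TP _)

lemma phi_TP (q : ℕ) : (fun x => (phi q x : ℂ)) ∈ TP (q ^ 2) := by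
  have : (fun x => (phi q x : ℂ)) = ((1 / (q : ℂ) ^ 4)) • (fun x => ((‖SS (q ^ 2) x‖ ^ 2 : ℝ) : ℂ)) := by
    funext x; simp [phi]; ring
  rw [this]
  exact Submodule.smul_mem _ _ (SS_TP _)

lemma hh_TP (q : ℕ) (a : ℝ) : (fun x => (hh q a x : ℂ)) ∈ TP (q ^ 2) := by
  have : (fun x => (hh q a x : ℂ)) = (1 - a : ℂ) • (1 : ℝ → ℂ) + (a : ℂ) • (fun x => (FF q x : ℂ)) := by
    funext x; simp [hh]
  rw [this]
  exact Submodule.add_mem _ (Submodule.smul_mem _ _ (TP_one _)) (Submodule.smul_mem _ _ (FF_TP _))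

lemma hphi_TP (q : ℕ) (a : ℝ) :
    (fun x => ((hh q a x * (1 - phi q x) : ℝ) : ℂ)) ∈ TP (2 * q ^ 2) := by
  have : (fun x => ((hh q a x * (1 - phi q x) : ℝ) : ℂ))
      = (fun x => (hh q a x : ℂ)) * ((1 : ℝ → ℂ) - (fun x => (phi q x : ℂ))) := by
    funext x; simp
  rw [this, two_mul]
  exact TP_mul (hh_TP q a) (Submodule.sub_mem _ (TP_one _) (phi_TP _))

/-- general product -/
noncomputable def RR (q : ℕ → ℕ) (w : ℕ → ℝ → ℝ) (M : ℕ) (x : ℝ) : ℝ :=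
  ∏ m ∈ range M, w m (q m * x)

def ss (q : ℕ → ℕ) (M : ℕ) : ℕ := ∑ m ∈ range M, 2 * q m ^ 3

lemma ss_lt {q : ℕ → ℕ} (hq : ∀ m, 2 ≤ q m) (hg : ∀ m, 16 * q m ^ 3 < q (m + 1)) (M : ℕ) :
    2 * ss q M < q M := by
  induction M with
  | zero => simp [ss]; linarith [hq 0]
  | succ M ih =>
    have : ss q (M + 1) = ss q M + 2 * q M ^ 3 := by unfold ss; rw [Finset.sum_range_succ]
    have h1 := hg M
    have h2 : q M ≤ q M ^ 3 := Nat.le_self_pow (by norm_num) _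
    lia

lemma RR_succ (q : ℕ → ℕ) (w : ℕ → ℝ → ℝ) (M : ℕ) :
    (fun x => (RR q w (M + 1) x : ℂ)) = (fun x => (RR q w M x : ℂ)) *
      (fun x => (fun y => (w M y : ℂ)) (q M * x)) := by
  funext x; simp [RR, Finset.prod_range_succ]

lemma RR_TP {q : ℕ → ℕ} {w : ℕ → ℝ → ℝ} (hw : ∀ m, (fun x => (w m x : ℂ)) ∈ TP (2 * q m ^ 2))
    (M : ℕ) : (fun x => (RR q w M x : ℂ)) ∈ TP (ss q M) := by
  induction M with
  | zero =>
    have : (fun x => (RR q w 0 x : ℂ)) = 1 := by funext x; simp [RR]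
    rw [this]; exact TP_one _
  | succ M ih =>
    rw [RR_succ]
    have : ss q (M + 1) = ss q M + q M * (2 * q M ^ 2) := by
      unfold ss; rw [Finset.sum_range_succ]; ring
    rw [this]
    exact TP_mul ih (TP_dil _ (hw M))

lemma RR_int {q : ℕ → ℕ} (hq : ∀ m, 2 ≤ q m) (hg : ∀ m, 16 * q m ^ 3 < q (m + 1))
    {w : ℕ → ℝ → ℝ} (hw : ∀ m, (fun x => (w m x : ℂ)) ∈ TP (2 * q m ^ 2)) (M : ℕ) :
    ∫ x : unitInterval, RR q w M x = ∏ m ∈ range M, ∫ x : unitInterval, w m x := by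
  have key : LL (fun x => (RR q w M x : ℂ)) = ∏ m ∈ range M, LL (fun x => (w m x : ℂ)) := by
    induction M with
    | zero => simp [RR, LL]
    | succ M ih =>
      rw [RR_succ, LL_fact (d := ss q M) (by have := ss_lt hq hg M; lia) (RR_TP hw M) (hw M), ih,
        Finset.prod_range_succ]
  unfold LL at key
  simp_rw [integral_complex_ofReal] at key
  exact_mod_cast key

section
variable (q : ℕ → ℕ) (a : ℕ → ℝ)

noncomputable def PP (M : ℕ) (x : ℝ) : ℝ := RR q (fun m => hh (q m) (a m)) M x


lemma hw1 (m : ℕ) : (fun x => (hh (q m) (a m) x : ℂ)) ∈ TP (2 * q m ^ 2) :=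
  TP_mono (by lia) (hh_TP _ _)

lemma PP_TP (M : ℕ) : (fun x => (PP q a M x : ℂ)) ∈ TP (ss q M) := RR_TP (hw1 q a) M

lemma PP_cont (M : ℕ) : Continuous (PP q a M) := by
  unfold PP RR
  exact continuous_finsetProd _ fun m _ => (hh_cont _ _).comp (by fun_prop)

lemma PP_nonneg (h0 : ∀ m, 0 ≤ a m) (h1 : ∀ m, a m ≤ 1)
    (M : ℕ) (x : ℝ) : 0 ≤ PP q a M x := by
  unfold PP RR
  exact Finset.prod_nonneg fun m _ => hh_nonneg _ (h0 m) (h1 m) _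

lemma PP_int (hq : ∀ m, 2 ≤ q m) (hg : ∀ m, 16 * q m ^ 3 < q (m + 1))
    (M : ℕ) : ∫ x : unitInterval, PP q a M x = 1 := by
  unfold PP
  rw [RR_int hq hg (hw1 q a)]
  exact Finset.prod_eq_one fun m _ => hh_int (by linarith [hq m]) _

lemma PP_hat_top (hq : ∀ m, 2 ≤ q m) (hg : ∀ m, 16 * q m ^ 3 < q (m + 1)) (h0 : ∀ m, 0 ≤ a m) (h1 : ∀ m, a m ≤ 1)
    (M : ℕ) (n : ℤ) (hn : (ss q M : ℤ) < |n|) :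
    ‖LL (ee n * fun x => (PP q a (M + 1) x : ℂ))‖ ≤ a M := by
  have hM := ss_lt hq hg M
  set G : ℝ → ℝ := fun x => PP q a M x * FF (q M) (q M * x) with hG
  have hFc : Continuous (fun x : ℝ => FF (q M) (q M * x)) := (FF_cont _).comp (by fun_prop)
  have hGc : Continuous G := (PP_cont q a M).mul hFc
  have hGcc : Continuous (fun x => (G x : ℂ)) := by fun_prop
  have hPcc : Continuous (fun x => (PP q a M x : ℂ)) := TP_cont (PP_TP q a M)
  have e : (ee n * fun x => (PP q a (M + 1) x : ℂ)) =
      (1 - a M : ℂ) • (ee n * fun x => (PP q a M x : ℂ)) +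
      (a M : ℂ) • (ee n * fun x => (G x : ℂ)) := by
    funext x
    simp only [PP, RR, Finset.prod_range_succ, hh, hG, Pi.mul_apply, Pi.add_apply, Pi.smul_apply,
      smul_eq_mul]
    push_cast; ring
  rw [e, LL_add (((ee_cont n).mul hPcc).const_smul _) (((ee_cont n).mul hGcc).const_smul _),
    LL_smul, LL_smul, LL_high hn (PP_TP q a M), mul_zero, zero_add, norm_mul,
    Complex.norm_real, Real.norm_of_nonneg (h0 M)]
  have hGint : ∫ x : unitInterval, G x = 1 := by
    have k := LL_fact (d := ss q M) (q := q M) (by lia) (PP_TP q a M) (FF_TP (q M))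
    have k2 : LL (fun x => (G x : ℂ)) = 1 := by
      have : (fun x => (G x : ℂ)) = (fun x => (PP q a M x : ℂ)) * fun x => (fun y => (FF (q M) y : ℂ)) (q M * x) := by
        funext x; simp [hG]
      rw [this, k]
      unfold LL
      simp_rw [integral_complex_ofReal]
      rw [PP_int q a hq hg, FF_int (by linarith [hq M])]; simp
    unfold LL at k2
    rw [integral_complex_ofReal] at k2
    exact_mod_cast k2
  have : ‖LL (ee n * fun x => (G x : ℂ))‖ ≤ 1 := by
    unfold LL
    refine (norm_integral_le_integral_norm _).trans (le_of_eq ?_)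
    rw [← hGint]
    congr 1
    funext x
    simp only [Pi.mul_apply, norm_mul, ee, eneg_norm, one_mul, Complex.norm_real]
    exact Real.norm_of_nonneg (mul_nonneg (PP_nonneg q a h0 h1 M _) (FF_nonneg _ _))
  nlinarith [h0 M]

lemma PP_hat (hq : ∀ m, 2 ≤ q m) (hg : ∀ m, 16 * q m ^ 3 < q (m + 1)) (h0 : ∀ m, 0 ≤ a m) (h1 : ∀ m, a m ≤ 1)
    (ha : Antitone a) (M : ℕ) (n : ℤ) (hn : (q M : ℤ) ≤ |n|) (M' : ℕ) (hM' : M + 1 ≤ M') :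
    ‖LL (ee n * fun x => (PP q a M' x : ℂ))‖ ≤ a M := by
  induction M', hM' using Nat.le_induction with
  | base =>
    apply PP_hat_top q a hq hg h0 h1
    have := ss_lt hq hg M
    lia
  | succ M' hM' ih =>
    by_cases hc : (ss q M' : ℤ) < |n|
    · exact (PP_hat_top q a hq hg h0 h1 M' n hc).trans (ha (by lia))
    · push Not at hc
      have k := LL_fact (d := ss q M' + ss q M') (q := q M') (by have := ss_lt hq hg M'; lia)
        (TP_mul (ee_mem hc) (PP_TP q a M')) (hw1 q a M')
      unfold PP
      rw [RR_succ, ← mul_assoc]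
      unfold PP at k ih
      rw [k]
      have : LL (fun x => (hh (q M') (a M') x : ℂ)) = 1 := by
        unfold LL
        simp_rw [integral_complex_ofReal]
        rw [hh_int (by linarith [hq M'])]; simp
      rw [this, mul_one]
      exact ih

lemma PP_test (hq : ∀ m, 2 ≤ q m) (hg : ∀ m, 16 * q m ^ 3 < q (m + 1)) (h0 : ∀ m, 0 ≤ a m) (h1 : ∀ m, a m ≤ 1)
    (T : Finset ℕ) (M : ℕ) (hT : ∀ m ∈ T, m < M) :
    ∫ x : unitInterval, PP q a M x * ∏ m ∈ T, (1 - phi (q m) (q m * x))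
      ≤ ∏ m ∈ T, (1 - a m / 96) := by
  classical
  set w : ℕ → ℝ → ℝ := fun m x => if m ∈ T then hh (q m) (a m) x * (1 - phi (q m) x)
    else hh (q m) (a m) x with hwdef
  have hw : ∀ m, (fun x => (w m x : ℂ)) ∈ TP (2 * q m ^ 2) := by
    intro m
    by_cases h : m ∈ T
    · simp only [hwdef, h, if_true]; exact hphi_TP _ _
    · simp only [hwdef, h, if_false]; exact hw1 q a m
  have hTM : T ⊆ range M := fun m hm => Finset.mem_range.2 (hT m hm)
  have e : ∀ x : ℝ, PP q a M x * ∏ m ∈ T, (1 - phi (q m) (q m * x)) = RR q w M x := by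
    intro x
    unfold PP RR
    have : ∏ m ∈ T, (1 - phi (q m) (q m * x)) =
        ∏ m ∈ range M, if m ∈ T then (1 - phi (q m) (q m * x)) else 1 := by
      rw [Finset.prod_ite_mem, Finset.inter_eq_right.2 hTM]
    rw [this, ← Finset.prod_mul_distrib]
    refine Finset.prod_congr rfl fun m _ => ?_
    simp only [hwdef]
    split_ifs <;> simp
  simp_rw [e]
  rw [RR_int hq hg hw]
  have : ∏ m ∈ T, (1 - a m / 96) = ∏ m ∈ range M, if m ∈ T then (1 - a m / 96) else 1 := by
    rw [Finset.prod_ite_mem, Finset.inter_eq_right.2 hTM]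
  rw [this]
  have hq1 : ∀ m, 1 ≤ q m := fun m => by linarith [hq m]
  refine Finset.prod_le_prod (fun m _ => ?_) fun m _ => ?_
  · apply integral_nonneg
    intro x
    simp only [hwdef, Pi.zero_apply]
    have := hh_nonneg (q m) (h0 m) (h1 m) x
    split_ifs
    · exact mul_nonneg this (by linarith [phi_le (q m) x])
    · exact this
  · by_cases h : m ∈ T
    · simp only [hwdef, h, if_true]; exact hphi_int (hq1 m) (h0 m) (h1 m)
    · simp only [hwdef, h, if_false]; exact (hh_int (hq1 m) _).le

lemma exists_limit (hq : ∀ m, 2 ≤ q m) (hg : ∀ m, 16 * q m ^ 3 < q (m + 1)) (h0 : ∀ m, 0 ≤ a m) (h1 : ∀ m, a m ≤ 1)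
    (ha : Antitone a) : ∃ μ : ProbabilityMeasure unitInterval,
    (∀ (M : ℕ) (n : ℤ), (q M : ℤ) ≤ |n| → ‖∫ x, ee n x ∂(μ : Measure unitInterval)‖ ≤ a M) ∧
    (∀ T : Finset ℕ, ∫ x, ∏ m ∈ T, (1 - phi (q m) (q m * (x : ℝ))) ∂(μ : Measure unitInterval)
      ≤ ∏ m ∈ T, (1 - a m / 96)) := by
  let d : ℕ → unitInterval → NNReal := fun M x => (PP q a M x).toNNReal
  have hd : ∀ M, Continuous (d M) := fun M =>
    continuous_real_toNNReal.comp ((PP_cont q a M).comp continuous_subtype_val)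
  have hdc : ∀ M x, ((d M x : NNReal) : ℝ) = PP q a M x := fun M x =>
    Real.coe_toNNReal _ (PP_nonneg q a h0 h1 M _)
  let ν : ℕ → Measure unitInterval := fun M => volume.withDensity (fun x => (d M x : ENNReal))
  have hν : ∀ M, IsProbabilityMeasure (ν M) := by
    intro M
    constructor
    simp only [ν]
    rw [withDensity_apply _ MeasurableSet.univ, Measure.restrict_univ]
    change ∫⁻ x : unitInterval, ENNReal.ofReal (PP q a M x) = 1
    rw [← ofReal_integral_eq_lintegral_ofReal (cont_int (PP_cont q a M) _)
      (Eventually.of_forall fun x => PP_nonneg q a h0 h1 M _), PP_int q a hq hg]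
    simp
  let p : ℕ → ProbabilityMeasure unitInterval := fun M => ⟨ν M, hν M⟩
  let U : Ultrafilter ℕ := hyperfilter ℕ
  have hU : (U : Filter ℕ) ≤ atTop := Nat.hyperfilter_le_atTop
  obtain ⟨μ, -, hμ⟩ := (isCompact_univ (X := ProbabilityMeasure unitInterval)).ultrafilter_le_nhds
    (U.map p) (by simp)
  have hμ : Tendsto p U (nhds μ) := hμ
  have hintegral : ∀ M (E : Type) [NormedAddCommGroup E] [NormedSpace ℝ E] (g : unitInterval → E),
      ∫ x, g x ∂(p M : Measure unitInterval) = ∫ x : unitInterval, PP q a M x • g x := by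
    intro M E _ _ g
    change ∫ x, g x ∂(ν M) = _
    simp only [ν]
    rw [integral_withDensity_eq_integral_smul (hd M).measurable]
    congr 1
    funext x
    rw [NNReal.smul_def, hdc]
  refine ⟨μ, ?_, ?_⟩
  · intro M n hn
    let f : BoundedContinuousFunction unitInterval ℂ :=
      BoundedContinuousFunction.mkOfCompact ⟨fun x => ee n x, (ee_cont n).comp continuous_subtype_val⟩
    have h := (ProbabilityMeasure.tendsto_iff_forall_integral_rclike_tendsto ℂ).1 hμ f
    refine le_of_tendsto h.norm ?_
    filter_upwards [hU (eventually_ge_atTop (M + 1))] with M' hM'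
    rw [hintegral]
    have := PP_hat q a hq hg h0 h1 ha M n hn M' hM'
    refine le_trans (le_of_eq ?_) this
    unfold LL
    congr 2
    funext x
    simp [f, mul_comm]
  · intro T
    have hc : Continuous fun x : unitInterval => ∏ m ∈ T, (1 - phi (q m) (q m * (x : ℝ))) :=
      continuous_finsetProd _ fun m _ => continuous_const.sub ((phi_cont _).comp (by fun_prop))
    let f : BoundedContinuousFunction unitInterval ℝ :=
      BoundedContinuousFunction.mkOfCompact ⟨_, hc⟩
    have h := ProbabilityMeasure.tendsto_iff_forall_integral_tendsto.1 hμ f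
    refine le_of_tendsto h ?_
    filter_upwards [hU (eventually_ge_atTop (T.sup id + 1))] with M' hM'
    rw [hintegral]
    exact PP_test q a hq hg h0 h1 T M' fun m hm => by
      have : m ≤ T.sup id := Finset.le_sup (f := id) hm
      lia

end

lemma digit_cases {b : ℕ} (hb : 2 ≤ b) {x : ℝ} {N : ℕ}
    (h : |(b : ℝ) ^ N * x - round ((b : ℝ) ^ N * x)| < 1 / (b : ℝ) ^ N) :
    (∀ j ∈ Finset.Ioc N (2 * N), digit b x j = 0) ∨
    (∀ j ∈ Finset.Ioc N (2 * N), digit b x j ≠ 0) := by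
  set A : ℤ := round ((b : ℝ) ^ N * x) - (b : ℤ) ^ N * ⌊x⌋ with hA
  set y := Int.fract x with hy
  have hb0 : (0 : ℝ) < b := by positivity
  have hb1 : (1 : ℝ) ≤ b := by exact_mod_cast (by lia : 1 ≤ b)
  have hyA : (b : ℝ) ^ N * x - round ((b : ℝ) ^ N * x) = y * (b : ℝ) ^ N - A := by
    rw [hA, hy, Int.fract]; push_cast; ring
  rw [hyA] at h
  have hy0 : 0 ≤ y := Int.fract_nonneg x
  have hle1 : 1 / (b : ℝ) ^ N ≤ 1 := by
    rw [div_le_one (by positivity)]; exact one_le_pow₀ hb1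
  have hA0 : 0 ≤ A := by
    have h1 := (abs_lt.1 h).2
    have h2 : 0 ≤ y * (b : ℝ) ^ N := by positivity
    have : (-1 : ℝ) < A := by linarith
    have : (-1 : ℤ) < A := by exact_mod_cast this
    lia
  obtain ⟨B, hB⟩ := Int.eq_ofNat_of_zero_le hA0
  have hBr : (A : ℝ) = B := by rw [hB]; simp
  rw [hBr] at h
  have hsmall : ∀ j ∈ Finset.Ioc N (2 * N), ∃ i, 1 ≤ i ∧ j = N + i ∧
      |y * (b : ℝ) ^ j - ((B * b ^ i : ℕ) : ℝ)| < 1 := by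
    intro j hj
    rw [Finset.mem_Ioc] at hj
    refine ⟨j - N, by lia, by lia, ?_⟩
    obtain ⟨i, rfl⟩ : ∃ i, j = N + i := ⟨j - N, by lia⟩
    simp only [Nat.add_sub_cancel_left]
    have e : y * (b : ℝ) ^ (N + i) - ((B * b ^ i : ℕ) : ℝ) = (y * (b : ℝ) ^ N - B) * (b : ℝ) ^ i := by
      push_cast; ring
    rw [e, abs_mul, abs_of_pos (a := (b : ℝ) ^ i) (by positivity)]
    calc _ < 1 / (b : ℝ) ^ N * (b : ℝ) ^ i := by gcongr
      _ ≤ 1 / (b : ℝ) ^ N * (b : ℝ) ^ N := by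
        have : i ≤ N := by lia
        gcongr
      _ = 1 := by field_simp
  by_cases hc : (B : ℝ) ≤ y * (b : ℝ) ^ N
  · left
    intro j hj
    obtain ⟨i, hi, rfl, hlt⟩ := hsmall j hj
    have h3 : ((B * b ^ i : ℕ) : ℝ) ≤ y * (b : ℝ) ^ (N + i) := by
      rw [pow_add, ← mul_assoc]; push_cast; gcongr
    have : ⌊y * (b : ℝ) ^ (N + i)⌋₊ = B * b ^ i := by
      rw [Nat.floor_eq_iff (by positivity)]
      exact ⟨h3, by linarith [(abs_lt.1 hlt).2]⟩
    unfold digit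
    rw [← hy, this]
    obtain ⟨i', rfl⟩ : ∃ i', i = i' + 1 := ⟨i - 1, by lia⟩
    rw [pow_succ, ← mul_assoc]
    simp
  · right
    push Not at hc
    intro j hj
    obtain ⟨i, hi, rfl, hlt⟩ := hsmall j hj
    have hBpos : 1 ≤ B := by
      rcases Nat.eq_zero_or_pos B with h0 | h0
      · subst h0
        have : 0 ≤ y * (b : ℝ) ^ N := by positivity
        simp at hc; linarith
      · exact h0
    have h3 : y * (b : ℝ) ^ (N + i) < ((B * b ^ i : ℕ) : ℝ) := by
      rw [pow_add, ← mul_assoc]; push_cast; gcongr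
    have hpos : 1 ≤ B * b ^ i := Nat.mul_pos hBpos (by positivity)
    have : ⌊y * (b : ℝ) ^ (N + i)⌋₊ = B * b ^ i - 1 := by
      rw [Nat.floor_eq_iff (by positivity), Nat.cast_sub hpos]
      refine ⟨?_, ?_⟩
      · have := (abs_lt.1 hlt).1; push_cast at *; linarith
      · push_cast at *; linarith
    unfold digit
    rw [← hy, this]
    obtain ⟨i', rfl⟩ : ∃ i', i = i' + 1 := ⟨i - 1, by lia⟩
    intro hmod
    have hd := Nat.dvd_of_mod_eq_zero hmod
    have hd2 : b ∣ B * b ^ (i' + 1) := Dvd.intro_left (B * b ^ i') (by ring)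
    have := (Nat.dvd_sub hd2 hd)
    rw [show B * b ^ (i' + 1) - (B * b ^ (i' + 1) - 1) = 1 by lia] at this
    have := Nat.le_of_dvd one_pos this
    lia

lemma not_normal {b : ℕ} (hb : 2 ≤ b) {x : ℝ}
    (h : ∀ K : ℕ, ∃ N ≥ K, |(b : ℝ) ^ N * x - round ((b : ℝ) ^ N * x)| < 1 / (b : ℝ) ^ N) :
    ¬ IsNormal b x := by
  intro hn
  have h1 := hn 1 le_rfl (fun _ => 0) (fun _ => by lia)
  simp only [pow_one] at h1
  set P : ℕ → Prop := fun n => ∀ i : Fin 1, digit b x (n + (i : ℕ)) = 0 with hP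
  have hPi : ∀ n, P n ↔ digit b x n = 0 := by intro n; simp [hP]
  have hb2 : (2 : ℝ) ≤ b := by exact_mod_cast hb
  have h2 : Tendsto (fun N : ℕ => 2 * N) atTop atTop :=
    tendsto_atTop_mono (fun n => by simp only [id]; lia) tendsto_id
  have h3 := ((h1.comp h2).const_mul 2).sub h1
  rw [show 2 * (1 / (b : ℝ)) - 1 / b = 1 / b by ring] at h3
  have h4 := (Metric.tendsto_nhds.1 h3) (1 / b) (by positivity)
  obtain ⟨K, hK⟩ := eventually_atTop.1 h4
  obtain ⟨N, hN, hx⟩ := h (K + 1)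
  have h5 := hK N (by lia)
  simp only [Function.comp] at h5
  have hN0 : (0 : ℝ) < N := by exact_mod_cast (by lia : 0 < N)
  have hcard : ((Finset.Icc 1 (2 * N)).filter P).card =
      ((Finset.Icc 1 N).filter P).card + ((Finset.Ioc N (2 * N)).filter P).card := by
    rw [← Finset.card_union_of_disjoint, ← Finset.filter_union]
    · congr 2
      ext j; simp only [Finset.mem_Icc, Finset.mem_union, Finset.mem_Ioc]; lia
    · apply Finset.disjoint_filter_filter
      rw [Finset.disjoint_left]
      intro j; simp only [Finset.mem_Icc, Finset.mem_Ioc]; lia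
  rw [hcard, Real.dist_eq] at h5
  have key : ∀ u v : ℝ, 2 * ((u + v) / ((2 * N : ℕ) : ℝ)) - u / N = v / N := by
    intro u v; push_cast; field_simp; ring
  rw [Nat.cast_add, key] at h5
  have hbinv : 1 / (b : ℝ) ≤ 1 / 2 := by gcongr
  rcases digit_cases hb hx with hc | hc
  · rw [Finset.filter_true_of_mem (fun j hj => (hPi j).2 (hc j hj))] at h5
    rw [Nat.card_Ioc, show 2 * N - N = N by lia, div_self hN0.ne'] at h5
    rw [abs_of_nonneg (by linarith)] at h5
    linarith
  · rw [Finset.filter_false_of_mem (fun j hj => fun hp => hc j hj ((hPi j).1 hp))] at h5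
    simp at h5

def bb (m : ℕ) : ℕ := (Nat.unpair m).1 + 2
def NN (m : ℕ) : ℕ := 2 ^ ((m + 1) ^ 2)
def qq (m : ℕ) : ℕ := bb m ^ NN m
noncomputable def aa (m : ℕ) : ℝ := 1 / ((Nat.sqrt m : ℝ) + 1)

lemma bb_le (m : ℕ) : bb m ≤ m + 2 := by
  unfold bb; have := Nat.unpair_left_le m; lia

lemma le_NN (m : ℕ) : m + 1 ≤ NN m := by
  unfold NN
  calc m + 1 ≤ (m + 1) ^ 2 := Nat.le_self_pow (by norm_num) _
    _ ≤ _ := Nat.lt_two_pow_self.le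

lemma two_le_qq (m : ℕ) : 2 ^ (m + 1) ≤ qq m := by
  unfold qq
  calc 2 ^ (m + 1) ≤ 2 ^ NN m := Nat.pow_le_pow_right (by norm_num) (le_NN m)
    _ ≤ _ := Nat.pow_le_pow_left (by unfold bb; lia) _

lemma qq_ge (m : ℕ) : 2 ≤ qq m := by
  refine le_trans ?_ (two_le_qq m)
  calc 2 = 2 ^ 1 := by norm_num
    _ ≤ _ := Nat.pow_le_pow_right (by norm_num) (by lia)

lemma qq_growth (m : ℕ) : 16 * qq m ^ 3 < qq (m + 1) := by
  have h1 : bb m ≤ 2 ^ (m + 1) := (bb_le m).trans Nat.lt_two_pow_self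
  have h2 : 16 * qq m ^ 3 ≤ 2 ^ (4 + (m + 1) * NN m * 3) := by
    rw [pow_add, pow_mul, pow_mul]
    unfold qq
    gcongr
    norm_num
  have h3 : 2 ^ NN (m + 1) ≤ qq (m + 1) := Nat.pow_le_pow_left (by unfold bb; lia) _
  have h4 : NN (m + 1) = NN m * (8 * 4 ^ m) := by
    unfold NN
    rw [show (8 : ℕ) = 2 ^ 3 by norm_num, show (4 : ℕ) = 2 ^ 2 by norm_num, ← pow_mul, ← pow_add,
      ← pow_add]
    congr 1; ring
  have h5 : m + 1 ≤ 4 ^ m := Nat.lt_pow_self (by norm_num)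
  have h6 : m + 1 ≤ NN m := le_NN m
  have h7 : 2 ≤ NN m := by
    unfold NN
    calc 2 = 2 ^ 1 := by norm_num
      _ ≤ _ := Nat.pow_le_pow_right (by norm_num) (Nat.one_le_pow _ _ (by lia))
  have h8 : 4 + (m + 1) * NN m * 3 < NN (m + 1) := by
    rw [h4]
    have : NN m * (m + 1) ≤ NN m * 4 ^ m := Nat.mul_le_mul_left _ h5
    have : 2 ≤ NN m * (m + 1) := by nlinarith
    nlinarith
  calc _ ≤ _ := h2
    _ < 2 ^ NN (m + 1) := Nat.pow_lt_pow_right (by norm_num) h8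
    _ ≤ _ := h3

lemma aa_nonneg (m : ℕ) : 0 ≤ aa m := by unfold aa; positivity
lemma aa_le (m : ℕ) : aa m ≤ 1 := by
  unfold aa
  apply div_le_one_of_le₀ _ (by positivity)
  have : (0 : ℝ) ≤ (Nat.sqrt m : ℝ) := by positivity
  linarith
lemma aa_anti : Antitone aa := by
  intro m n h
  unfold aa
  have : Nat.sqrt m ≤ Nat.sqrt n := Nat.sqrt_le_sqrt h
  gcongr
lemma aa_pair (β k : ℕ) : 1 / ((k : ℝ) + β + 1) ≤ aa (Nat.pair β k) := by
  unfold aa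
  have h : Nat.sqrt (Nat.pair β k) < max β k + 1 := by
    rw [Nat.sqrt_lt']; exact Nat.pair_lt_max_add_one_sq β k
  have h2 : Nat.sqrt (Nat.pair β k) ≤ k + β := by lia
  have h3 : ((Nat.sqrt (Nat.pair β k) : ℕ) : ℝ) ≤ k + β := by exact_mod_cast h2
  gcongr

lemma prod_ge (u : ℕ → ℝ) (hu : ∀ m, 0 ≤ u m) (hu1 : ∀ m, u m ≤ 1) (T : Finset ℕ) :
    1 - ∑ m ∈ T, u m ≤ ∏ m ∈ T, (1 - u m) := by
  classical
  induction T using Finset.induction_on with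
  | empty => simp
  | insert m T hm ih =>
    rw [Finset.sum_insert hm, Finset.prod_insert hm]
    have h1 : ∏ m ∈ T, (1 - u m) ≤ 1 :=
      Finset.prod_le_one (fun i _ => by linarith [hu1 i]) (fun i _ => by linarith [hu i])
    nlinarith [hu m]

lemma eps_sum (T : Finset ℕ) : ∑ m ∈ T, 1 / (qq m : ℝ) ^ 2 ≤ 1 / 2 := by
  have h1 : ∀ m, 1 / (qq m : ℝ) ^ 2 ≤ 1 / 4 * (1 / 2 : ℝ) ^ m := by
    intro m
    have h : (2 : ℝ) ^ (m + 1) ≤ qq m := by exact_mod_cast two_le_qq m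
    have h2 : (4 : ℝ) * 2 ^ m ≤ (qq m : ℝ) ^ 2 := by
      calc (4 : ℝ) * 2 ^ m ≤ 4 * 2 ^ m * 2 ^ m := by
            have : (1 : ℝ) ≤ 2 ^ m := one_le_pow₀ (by norm_num)
            nlinarith
        _ = (2 ^ (m + 1)) ^ 2 := by ring
        _ ≤ _ := by gcongr
    calc 1 / (qq m : ℝ) ^ 2 ≤ 1 / (4 * 2 ^ m) := by gcongr
      _ = _ := by rw [one_div_pow]; field_simp
  calc _ ≤ ∑ m ∈ T, 1 / 4 * (1 / 2 : ℝ) ^ m := Finset.sum_le_sum fun m _ => h1 m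
    _ = 1 / 4 * ∑ m ∈ T, (1 / 2 : ℝ) ^ m := by rw [Finset.mul_sum]
    _ ≤ 1 / 4 * 2 := by
      gcongr
      refine (summable_geometric_two.sum_le_tsum T (fun i _ => by positivity)).trans ?_
      exact tsum_geometric_two.le
    _ = _ := by norm_num

lemma harm_div (c : ℕ) : Tendsto (fun R : ℕ => ∑ k ∈ range R, 1 / ((k : ℝ) + c + 1)) atTop atTop := by
  have h := Real.tendsto_sum_range_one_div_nat_succ_atTop
  have h2 : Tendsto (fun R : ℕ => (∑ k ∈ range (R + c), 1 / ((k : ℝ) + 1)) -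
      ∑ k ∈ range c, 1 / ((k : ℝ) + 1)) atTop atTop :=
    tendsto_atTop_add_const_right _ _ (h.comp (tendsto_add_atTop_nat c))
  refine h2.congr fun R => ?_
  rw [add_comm R c, Finset.sum_range_add, add_sub_cancel_left]
  refine Finset.sum_congr rfl fun k _ => ?_
  push_cast; ring_nf

lemma null_set (μ : ProbabilityMeasure unitInterval)
    (hT : ∀ T : Finset ℕ, ∫ x, ∏ m ∈ T, (1 - phi (qq m) (qq m * (x : ℝ))) ∂(μ : Measure unitInterval)
      ≤ ∏ m ∈ T, (1 - aa m / 96)) (β K : ℕ) :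
    (μ : Measure unitInterval) {x | ∀ k, phi (qq (Nat.pair β (K + k))) (qq (Nat.pair β (K + k)) * (x : ℝ))
      ≤ 1 / (qq (Nat.pair β (K + k)) : ℝ) ^ 2} = 0 := by
  classical
  set B : Set unitInterval := {x | ∀ k, phi (qq (Nat.pair β (K + k))) (qq (Nat.pair β (K + k)) * (x : ℝ))
      ≤ 1 / (qq (Nat.pair β (K + k)) : ℝ) ^ 2} with hB
  have hinj : Function.Injective (fun k => Nat.pair β (K + k)) := by
    intro k k' h
    have := (Nat.pair_eq_pair.1 h).2
    lia
  have hbound : ∀ R : ℕ, (μ : Measure unitInterval).real B ≤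
      2 * Real.exp (-(1 / 96 * ∑ k ∈ range R, 1 / ((k : ℝ) + (K + β : ℕ) + 1))) := by
    intro R
    set T : Finset ℕ := (range R).image (fun k => Nat.pair β (K + k)) with hTdef
    have hc : Continuous fun x : ℝ => ∏ m ∈ T, (1 - phi (qq m) (qq m * x)) :=
      continuous_finsetProd _ fun m _ => continuous_const.sub ((phi_cont _).comp (by fun_prop))
    have hmk := mul_meas_ge_le_integral_of_nonneg (μ := (μ : Measure unitInterval))
      (f := fun x : unitInterval => ∏ m ∈ T, (1 - phi (qq m) (qq m * (x : ℝ))))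
      (Eventually.of_forall fun x => Finset.prod_nonneg fun m _ => by linarith [phi_le (qq m) (qq m * (x : ℝ))])
      (cont_int hc _) (1 / 2)
    have hsub : B ⊆ {x : unitInterval | 1 / 2 ≤ ∏ m ∈ T, (1 - phi (qq m) (qq m * (x : ℝ)))} := by
      intro x hx
      have hx' : ∀ k, phi (qq (Nat.pair β (K + k))) (qq (Nat.pair β (K + k)) * (x : ℝ))
        ≤ 1 / (qq (Nat.pair β (K + k)) : ℝ) ^ 2 := hx
      rw [Set.mem_ofPred_eq]
      have e1 : ∀ m, 1 / (qq m : ℝ) ^ 2 ≤ 1 := fun m => by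
        have : (1 : ℝ) ≤ qq m := by exact_mod_cast (le_trans (by norm_num) (qq_ge m))
        apply div_le_one_of_le₀ _ (by positivity)
        exact one_le_pow₀ this
      calc (1 : ℝ) / 2 ≤ 1 - ∑ m ∈ T, 1 / (qq m : ℝ) ^ 2 := by linarith [eps_sum T]
        _ ≤ ∏ m ∈ T, (1 - 1 / (qq m : ℝ) ^ 2) :=
          prod_ge (fun m => 1 / (qq m : ℝ) ^ 2) (fun m => by positivity) e1 T
        _ ≤ _ := by
          apply Finset.prod_le_prod
          · intro m _; linarith [e1 m]
          · intro m hm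
            obtain ⟨k, _, rfl⟩ := Finset.mem_image.1 hm
            linarith [hx' k]
    have h1 := measureReal_mono (μ := (μ : Measure unitInterval)) hsub
    have h2 := hT T
    have h3 : ∏ m ∈ T, (1 - aa m / 96) ≤
        Real.exp (-(1 / 96 * ∑ k ∈ range R, 1 / ((k : ℝ) + (K + β : ℕ) + 1))) := by
      rw [hTdef, Finset.prod_image (fun _ _ _ _ h => hinj h), Finset.mul_sum, ← Finset.sum_neg_distrib,
        Real.exp_sum]
      apply Finset.prod_le_prod
      · intro k _; linarith [aa_le (Nat.pair β (K + k))]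
      · intro k _
        refine le_trans ?_ (Real.add_one_le_exp _)
        have := aa_pair β (K + k)
        have e : ((K + k : ℕ) : ℝ) + β + 1 = (k : ℝ) + (K + β : ℕ) + 1 := by push_cast; ring
        rw [e] at this
        linarith
    linarith
  have hlim : Tendsto (fun R : ℕ => 2 * Real.exp (-(1 / 96 * ∑ k ∈ range R, 1 / ((k : ℝ) + (K + β : ℕ) + 1))))
      atTop (nhds (2 * 0)) := by
    apply Tendsto.const_mul
    apply Real.tendsto_exp_neg_atTop_nhds_zero.comp
    exact (harm_div (K + β)).const_mul_atTop (by norm_num)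
  have := ge_of_tendsto' hlim hbound
  rw [mul_zero] at this
  have h0 : (μ : Measure unitInterval).real B = 0 := le_antisymm this measureReal_nonneg
  rwa [measureReal_eq_zero_iff] at h0

lemma log_bound {M : ℕ} {r : ℝ} (hr : Real.exp (Real.exp (Real.exp 1)) ≤ r) (h : r ≤ qq (M + 1)) :
    0 < Real.log (Real.log (Real.log r)) ∧
    Real.log (Real.log (Real.log r)) * aa M ≤ 8 := by
  have l1 : Real.exp (Real.exp 1) ≤ Real.log r := by
    rw [← Real.log_exp (Real.exp (Real.exp 1))]
    exact Real.log_le_log (Real.exp_pos _) hr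
  have l2 : Real.exp 1 ≤ Real.log (Real.log r) := by
    rw [← Real.log_exp (Real.exp 1)]
    exact Real.log_le_log (Real.exp_pos _) l1
  have l3 : 1 ≤ Real.log (Real.log (Real.log r)) := by
    conv_lhs => rw [← Real.log_exp 1]
    exact Real.log_le_log (Real.exp_pos _) l2
  have p0 : 0 < r := (Real.exp_pos _).trans_le hr
  have p1 : 0 < Real.log r := (Real.exp_pos _).trans_le l1
  have p2 : 0 < Real.log (Real.log r) := (Real.exp_pos _).trans_le l2
  refine ⟨by linarith, ?_⟩
  have u1 : Real.log r ≤ 2 ^ ((M + 3) ^ 2) := by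
    refine (Real.log_le_log p0 h).trans ?_
    unfold qq
    push_cast
    rw [Real.log_pow]
    have hb : (bb (M + 1) : ℝ) ≤ M + 3 := by exact_mod_cast (bb_le (M + 1))
    have hb0 : (0 : ℝ) < bb (M + 1) := by unfold bb; positivity
    have k1 : Real.log (bb (M + 1)) ≤ M + 2 := by
      have := Real.log_le_sub_one_of_pos hb0
      linarith
    have k2 : ((M : ℝ) + 2) ≤ 2 ^ (M + 2) := by
      exact_mod_cast (Nat.lt_two_pow_self (n := M + 2)).le
    unfold NN
    push_cast
    calc _ ≤ (2 : ℝ) ^ ((M + 1 + 1) ^ 2) * 2 ^ (M + 2) := by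
            gcongr; linarith
      _ = 2 ^ ((M + 2) ^ 2 + (M + 2)) := by rw [← pow_add]
      _ ≤ _ := by
        apply pow_le_pow_right₀ (by norm_num); nlinarith
  have u2 : Real.log (Real.log r) ≤ ((M : ℝ) + 3) ^ 2 := by
    refine (Real.log_le_log p1 u1).trans ?_
    rw [Real.log_pow]
    have : Real.log 2 ≤ 1 := by linarith [Real.log_two_lt_d9]
    push_cast
    nlinarith [sq_nonneg ((M : ℝ) + 3)]
  set s := Nat.sqrt M with hs
  have hM : (M : ℝ) + 3 ≤ ((s : ℝ) + 3) ^ 2 := by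
    have : M < (s + 1) * (s + 1) := Nat.lt_succ_sqrt M
    have : M + 3 ≤ (s + 3) ^ 2 := by nlinarith
    exact_mod_cast this
  have u3 : Real.log (Real.log (Real.log r)) ≤ 8 * ((s : ℝ) + 1) := by
    refine (Real.log_le_log p2 u2).trans ?_
    rw [Real.log_pow]
    have k1 : Real.log ((M : ℝ) + 3) ≤ 2 * Real.log ((s : ℝ) + 3) := by
      refine (Real.log_le_log (by positivity) hM).trans ?_
      rw [Real.log_pow]; push_cast; rfl
    have k2 := Real.log_le_sub_one_of_pos (show (0 : ℝ) < (s : ℝ) + 3 by positivity)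
    have : (0 : ℝ) ≤ s := by positivity
    push_cast
    linarith
  unfold aa
  rw [← hs, mul_one_div, div_le_iff₀ (by positivity)]
  exact u3

lemma find_M (k : ℕ) (hk : 4 ≤ k) : ∃ M, qq M ≤ k ∧ k ≤ qq (M + 1) := by
  have hex : ∃ M, k < qq M := ⟨k, lt_of_lt_of_le (lt_trans Nat.lt_two_pow_self
    (Nat.pow_lt_pow_right (by norm_num) (Nat.lt_succ_self k))) (two_le_qq k)⟩
  classical
  have h1 := Nat.find_spec hex
  have h2 : Nat.find hex ≠ 0 := by
    intro h
    rw [h] at h1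
    have : qq 0 = 4 := by
      simp [qq, bb, NN]
    lia
  obtain ⟨M, hM⟩ := Nat.exists_eq_succ_of_ne_zero h2
  refine ⟨M, ?_, ?_⟩
  · have := Nat.find_min hex (m := M) (by lia)
    lia
  · rw [hM] at h1; exact h1.le

lemma phi_fract (q q' : ℕ) (x : ℝ) : phi q (q' * Int.fract x) = phi q (q' * x) := by
  have : SS (q ^ 2) (q' * Int.fract x) = SS (q ^ 2) (q' * x) := by
    unfold SS
    refine Finset.sum_congr rfl fun j _ => ?_
    simp only [ee]
    have : ((j : ℤ) : ℝ) * (q' * x) = (j : ℤ) * (q' * Int.fract x) + ((j * (q' * ⌊x⌋) : ℤ) : ℝ) := by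
      push_cast
      rw [← mul_add, ← mul_add, Int.fract_add_floor]
    rw [this, eneg_add, eneg_int, mul_one]
  unfold phi
  rw [this]

/-- Proposition (Pramanik–Zhang, §Appendix): there is a probability measure `μ`
supported on the absolutely non-normal numbers in `[0,1)` whose Fourier coefficients
satisfy `|μ̂(n)| ≤ C / log log log |n|` for all sufficiently large `|n|`. -/
theorem rajchman_measure_on_absolutely_nonnormal_numbers :
    ∃ (C : ℝ) (μ : Measure ℝ), 0 < C ∧ IsProbabilityMeasure μ ∧
      μ ((Set.Ico (0:ℝ) 1)ᶜ) = 0 ∧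
      (∀ᵐ x ∂μ, ∀ b : ℕ, 2 ≤ b → ¬ IsNormal b x) ∧
      ∀ n : ℤ, C ≤ |(n : ℝ)| →
        ‖muHat μ n‖ ≤ C / Real.log (Real.log (Real.log |(n : ℝ)|)) := by
  obtain ⟨μ, hF, hT⟩ := exists_limit qq aa qq_ge qq_growth aa_nonneg aa_le aa_anti
  have hmeas : Measurable (fun x : unitInterval => Int.fract (x : ℝ)) :=
    measurable_fract.comp measurable_subtype_coe
  refine ⟨Real.exp (Real.exp (Real.exp 1)) + 100,
    (μ : Measure unitInterval).map (fun x : unitInterval => Int.fract (x : ℝ)), by positivity, ?_, ?_, ?_, ?_⟩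
  · exact Measure.isProbabilityMeasure_map hmeas.aemeasurable
  · rw [Measure.map_apply hmeas measurableSet_Ico.compl]
    have : (fun x : unitInterval => Int.fract (x : ℝ)) ⁻¹' (Set.Ico (0:ℝ) 1)ᶜ = ∅ := by
      ext x
      simp only [Set.mem_preimage, Set.mem_compl_iff, Set.mem_Ico, Set.mem_empty_iff_false, iff_false,
        not_not]
      exact ⟨Int.fract_nonneg _, Int.fract_lt_one _⟩
    rw [this]; simp
  · have h1 : ∀ᵐ x ∂((μ : Measure unitInterval).map (fun x : unitInterval => Int.fract (x : ℝ))),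
        ∀ β K : ℕ, ¬ ∀ k, phi (qq (Nat.pair β (K + k))) (qq (Nat.pair β (K + k)) * x)
            ≤ 1 / (qq (Nat.pair β (K + k)) : ℝ) ^ 2 := by
      rw [ae_all_iff]; intro β
      rw [ae_all_iff]; intro K
      rw [ae_iff]
      simp only [not_not]
      have hms : MeasurableSet {x : ℝ | ∀ k, phi (qq (Nat.pair β (K + k)))
          (qq (Nat.pair β (K + k)) * x) ≤ 1 / (qq (Nat.pair β (K + k)) : ℝ) ^ 2} := by
        rw [Set.ofPred_forall]
        refine MeasurableSet.iInter fun k => ?_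
        exact measurableSet_le ((phi_cont _).measurable.comp (measurable_const_mul _)) measurable_const
      rw [Measure.map_apply hmeas hms]
      have hn := null_set μ hT β K
      refine Eq.trans ?_ hn
      congr 1
      ext x
      simp only [Set.mem_preimage, Set.mem_ofPred_eq, phi_fract]
    filter_upwards [h1] with x hx b hb
    refine not_normal hb ?_
    intro K
    obtain ⟨β, rfl⟩ : ∃ β, b = β + 2 := ⟨b - 2, by lia⟩
    have := hx β K
    push Not at this
    obtain ⟨k, hk⟩ := this
    set m := Nat.pair β (K + k) with hm
    have hmK : K ≤ m := by
      have := Nat.right_le_pair β (K + k)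
      lia
    have hbm : bb m = β + 2 := by simp [bb, hm]
    refine ⟨NN m, by have := le_NN m; lia, ?_⟩
    have hqe : (((β + 2 : ℕ) : ℝ)) ^ NN m = (qq m : ℝ) := by
      unfold qq; rw [hbm]; push_cast; rfl
    rw [hqe]
    have hqpos : (0 : ℝ) < qq m := by
      have := qq_ge m
      exact_mod_cast (by lia : 0 < qq m)
    set y := (qq m : ℝ) * x with hy
    have hu := SS_upper (qq m ^ 2) y
    unfold phi at hk
    have hk2 : (qq m : ℝ) ^ 2 < ‖SS (qq m ^ 2) y‖ ^ 2 := by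
      rw [div_lt_div_iff₀ (by positivity) (by positivity)] at hk
      have e : (qq m : ℝ) ^ 4 = (qq m : ℝ) ^ 2 * (qq m : ℝ) ^ 2 := by ring
      rw [one_mul, e] at hk
      exact lt_of_mul_lt_mul_right hk (by positivity)
    have hk3 : (qq m : ℝ) < ‖SS (qq m ^ 2) y‖ := lt_of_pow_lt_pow_left₀ 2 (norm_nonneg _) hk2
    rw [lt_div_iff₀ hqpos]
    have := abs_nonneg (y - round y)
    nlinarith
  · intro n hn
    have hk : ((n.natAbs : ℕ) : ℝ) = |(n : ℝ)| := by rw [Nat.cast_natAbs]; push_cast; rfl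
    have hexp := Real.exp_pos (Real.exp (Real.exp 1))
    obtain ⟨M, hM1, hM2⟩ := find_M n.natAbs (by
      have : (4 : ℝ) ≤ (n.natAbs : ℝ) := by rw [hk]; linarith
      exact_mod_cast this)
    have hM2' : |(n : ℝ)| ≤ qq (M + 1) := by rw [← hk]; exact_mod_cast hM2
    obtain ⟨hpos, hle⟩ := log_bound (M := M) (r := |(n : ℝ)|) (by linarith) hM2'
    have hmu : muHat ((μ : Measure unitInterval).map (fun x : unitInterval => Int.fract (x : ℝ))) n =
        ∫ x : unitInterval, ee n x ∂(μ : Measure unitInterval) := by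
      unfold muHat
      change ∫ x, ee n x ∂_ = _
      rw [integral_map hmeas.aemeasurable
        (Continuous.aestronglyMeasurable (ee_cont n))]
      congr 1
      funext x
      simp only [ee]
      have : (n : ℝ) * (x : ℝ) = n * Int.fract (x : ℝ) + ((n * ⌊(x : ℝ)⌋ : ℤ) : ℝ) := by
        push_cast
        rw [← mul_add, Int.fract_add_floor]
      rw [this, eneg_add, eneg_int, mul_one]
    rw [hmu]
    refine (hF M n (by rw [Int.abs_eq_natAbs]; exact_mod_cast hM1)).trans ?_
    rw [le_div_iff₀ hpos, mul_comm]
    linarith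
end

section
/- There exists an absolute constant C₀ > 0 with the following property. Let s₁, s₂ ≥ 3 and a₁ < b₁, a₂ < b₂ be positive integers with 16 s₁^{b₁} < s₂^{a₂} and s₂^{a₂} > s₁^{3b₁}; let N₂ be defined by N₂ + 1 = ⌊s₂^{a₂} / s₁^{b₁}⌋; let 𝒟₁ ⊆ {0,1,…,s₁−1} be a digit set with 0 ∈ 𝒟₁ and s₁−1 ∉ 𝒟₁, and let ε₁ ∈ (0,1). Set 𝔊(ξ) := ( ε₁ 𝔅*₁(ξ) + (1 − ε₁) ℭ₁(ξ) ) · 𝔄(ξ; N₂, s₂, a₂), where 𝔅*₁ and ℭ₁ are formed with the parameters (s₁, a₁, b₁, 𝒟₁). Then |𝔊(ξ)| ≤ C₀ ( ε₁ + s₁^{a₁}/|ξ| + s₁^{b₁} s₂^{−a₂} ) for every ξ ∈ ℤ with 2 s₁^{a₁} ≤ |ξ| < s₁^{b₁/2} s₂^{a₂/2}. -/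
open Finset

/-- `1̂(θ) = ∫₀¹ e(xθ) dx`. -/
noncomputable def oneHat (θ : ℝ) : ℂ := ∫ x in (0:ℝ)..1, eneg (x * θ)

/-- The `j`-th base-`s` digit of the natural number `n`. -/
def digitOf (s n j : ℕ) : ℕ := n / s ^ j % s

/-- `𝔄(ξ; N, s, a) = N⁻¹ Σ_{k<N} e(ξ k s^{-a})`. -/
noncomputable def Afun (N s a : ℕ) (ξ : ℤ) : ℂ :=
  (N : ℂ)⁻¹ * ∑ k ∈ Finset.range N, eneg ((ξ : ℝ) * k / (s : ℝ) ^ a)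

/-- `ℭ(ξ) = s^{a-b} Σ_{ℓ < s^{b-a}} e(ξ ℓ s^{-b})`. -/
noncomputable def Cfun (s a b : ℕ) (ξ : ℤ) : ℂ :=
  (((s : ℝ) ^ a / (s : ℝ) ^ b : ℝ) : ℂ) *
    ∑ ℓ ∈ Finset.range (s ^ (b - a)), eneg ((ξ : ℝ) * ℓ / (s : ℝ) ^ b)

/-- `𝕃*`: the set of `ℓ < s^{b-a}` all of whose `b-a` base-`s` digits lie in `D`. -/
def Lstar (s a b : ℕ) (D : Finset ℕ) : Finset ℕ :=
  (Finset.range (s ^ (b - a))).filter fun ℓ => ∀ j < b - a, digitOf s ℓ j ∈ D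

/-- `𝔅*(ξ) = r^{a-b} Σ_{ℓ ∈ 𝕃*} e(ξ ℓ s^{-b})`, where `r = #D`. -/
noncomputable def Bstar (s a b : ℕ) (D : Finset ℕ) (ξ : ℤ) : ℂ :=
  (((D.card : ℝ) ^ a / (D.card : ℝ) ^ b : ℝ) : ℂ) *
    ∑ ℓ ∈ Lstar s a b D, eneg ((ξ : ℝ) * ℓ / (s : ℝ) ^ b)

/-- `g(ξ, k; s, 𝒜) = (#𝒜)⁻¹ Σ_{d ∈ 𝒜} e(ξ d s^{-k})`. -/
noncomputable def gfun (s : ℕ) (A : Finset ℕ) (ξ : ℤ) (k : ℕ) : ℂ :=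
  (A.card : ℂ)⁻¹ * ∑ d ∈ A, eneg ((ξ : ℝ) * d / (s : ℝ) ^ k)

lemma eneg_eq (y : ℝ) : eneg y = Complex.exp (Complex.I * ((-(2 * Real.pi * y) : ℝ) : ℂ)) := by
  unfold eneg
  congr 1
  push_cast
  ring

lemma norm_eneg (y : ℝ) : ‖eneg y‖ = 1 := by
  rw [eneg_eq, mul_comm]
  exact Complex.norm_exp_ofReal_mul_I _

lemma norm_one_sub_eneg (y : ℝ) : ‖eneg y - 1‖ = 2 * |Real.sin (Real.pi * y)| := by
  rw [eneg_eq, Complex.norm_exp_I_mul_ofReal_sub_one]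
  have : -(2 * Real.pi * y) / 2 = -(Real.pi * y) := by ring
  rw [this, Real.sin_neg, Real.norm_eq_abs, abs_mul, abs_neg]
  norm_num

lemma eneg_sub_int (y : ℝ) (k : ℤ) : eneg (y - k) = eneg y := by
  unfold eneg
  rw [Complex.exp_eq_exp_iff_exists_int]
  refine ⟨k, ?_⟩
  push_cast
  ring

lemma norm_eneg_upper (y : ℝ) (k : ℤ) : ‖eneg y - 1‖ ≤ 2 * Real.pi * |y - k| := by
  rw [← eneg_sub_int y k, norm_one_sub_eneg]
  have h := Real.abs_sin_le_abs (x := Real.pi * (y - k))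
  rw [abs_mul, abs_of_pos Real.pi_pos] at h
  linarith

lemma norm_eneg_lower (y : ℝ) (k : ℤ) (h : |y - k| ≤ 1 / 2) : 4 * |y - k| ≤ ‖eneg y - 1‖ := by
  rw [← eneg_sub_int y k, norm_one_sub_eneg]
  have hp := Real.pi_pos
  have h1 : |Real.pi * (y - k)| ≤ Real.pi / 2 := by
    rw [abs_mul, abs_of_pos hp]
    nlinarith
  have h2 := Real.mul_abs_le_abs_sin h1
  rw [abs_mul, abs_of_pos hp, ← mul_assoc, div_mul_cancel₀ _ hp.ne'] at h2
  linarith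

lemma eneg_mul_nat (y : ℝ) (k : ℕ) : eneg (y * k) = eneg y ^ k := by
  unfold eneg
  rw [← Complex.exp_nat_mul]
  congr 1
  push_cast
  ring

lemma geom_eneg (x Q : ℝ) (N : ℕ) :
    ‖∑ k ∈ Finset.range N, eneg (x * k / Q)‖ * ‖eneg (x / Q) - 1‖ = ‖eneg (x / Q * N) - 1‖ := by
  rw [← norm_mul, eneg_mul_nat, ← geom_sum_mul]
  have h : ∑ k ∈ Finset.range N, eneg (x * k / Q) = ∑ k ∈ Finset.range N, eneg (x / Q) ^ k := by
    refine Finset.sum_congr rfl fun k _ => ?_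
    rw [← eneg_mul_nat]
    congr 1
    ring
  rw [h]

lemma digits_inj (s m n n' : ℕ) (h : ∀ j < m, digitOf s n j = digitOf s n' j) :
    n % s ^ m = n' % s ^ m := by
  induction m with
  | zero => simp [Nat.mod_one]
  | succ m ih =>
    have h1 := ih fun j hj => h j (by omega)
    have h2 := h m (by omega)
    unfold digitOf at h2
    rw [Nat.mod_pow_succ, Nat.mod_pow_succ, h1, h2]

lemma card_Lstar (s a b : ℕ) (D : Finset ℕ) : (Lstar s a b D).card ≤ D.card ^ (b - a) := by
  have h1 : (Fintype.piFinset fun _ : Fin (b - a) => D).card = D.card ^ (b - a) := by simp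
  rw [← h1]
  refine Finset.card_le_card_of_injOn (fun n => fun j : Fin (b - a) => digitOf s n j) ?_ ?_
  · intro n hn
    simp only [Lstar, Finset.coe_filter, Set.mem_ofPred_eq] at hn
    simp only [Finset.mem_coe, Fintype.mem_piFinset]
    exact fun j => hn.2 j j.2
  · intro n hn n' hn' hh
    simp only [Lstar, Finset.coe_filter, Set.mem_ofPred_eq, Finset.mem_range] at hn hn'
    have := digits_inj s (b - a) n n' fun j hj => congrFun hh ⟨j, hj⟩
    rwa [Nat.mod_eq_of_lt hn.1, Nat.mod_eq_of_lt hn'.1] at this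

lemma norm_Bstar (s a b : ℕ) (D : Finset ℕ) (ξ : ℤ) (hab : a < b) (hD : 0 ∈ D) :
    ‖Bstar s a b D ξ‖ ≤ 1 := by
  unfold Bstar
  have hr : (0 : ℝ) < D.card := by exact_mod_cast Finset.card_pos.2 ⟨0, hD⟩
  have hs : ‖∑ ℓ ∈ Lstar s a b D, eneg ((ξ : ℝ) * ℓ / (s : ℝ) ^ b)‖ ≤ (D.card : ℝ) ^ (b - a) := by
    calc _ ≤ ∑ ℓ ∈ Lstar s a b D, (1 : ℝ) :=
          norm_sum_le_of_le _ fun ℓ _ => (norm_eneg _).le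
      _ = ((Lstar s a b D).card : ℝ) := by simp
      _ ≤ _ := by exact_mod_cast card_Lstar s a b D
  rw [norm_mul, Complex.norm_real, Real.norm_eq_abs, abs_of_pos (by positivity)]
  calc _ ≤ (D.card : ℝ) ^ a / (D.card : ℝ) ^ b * (D.card : ℝ) ^ (b - a) := by gcongr
    _ = 1 := by
      rw [div_mul_eq_mul_div, ← pow_add, Nat.add_sub_cancel' hab.le, div_self (by positivity)]

lemma norm_Afun (N s a : ℕ) (ξ : ℤ) (hN : 0 < N) : ‖Afun N s a ξ‖ ≤ 1 := by
  unfold Afun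
  have hN' : (0 : ℝ) < N := by exact_mod_cast hN
  have hs : ‖∑ k ∈ Finset.range N, eneg ((ξ : ℝ) * k / (s : ℝ) ^ a)‖ ≤ N := by
    calc _ ≤ ∑ k ∈ Finset.range N, (1 : ℝ) :=
          norm_sum_le_of_le _ fun ℓ _ => (norm_eneg _).le
      _ = _ := by simp
  rw [norm_mul, norm_inv, Complex.norm_natCast]
  calc _ ≤ (N : ℝ)⁻¹ * N := by gcongr
    _ = 1 := inv_mul_cancel₀ hN'.ne'

lemma Cfun_bound (s a b : ℕ) (ξ k : ℤ) (hs : 3 ≤ s) (hab : a < b)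
    (hk : |(ξ : ℝ) / (s : ℝ) ^ b - k| ≤ 1 / 2) :
    ‖Cfun s a b ξ‖ * |(ξ : ℝ) / (s : ℝ) ^ b - k| ≤ (s : ℝ) ^ a / (s : ℝ) ^ b / 2 := by
  unfold Cfun
  have hs' : (0 : ℝ) < s := by exact_mod_cast (by omega : 0 < s)
  have hg := geom_eneg (ξ : ℝ) ((s : ℝ) ^ b) (s ^ (b - a))
  have hu : ‖eneg ((ξ : ℝ) / (s : ℝ) ^ b * (s ^ (b - a) : ℕ)) - 1‖ ≤ 2 := by
    refine (norm_sub_le _ _).trans ?_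
    rw [norm_eneg]
    norm_num
  have hl := norm_eneg_lower _ k hk
  have hn := norm_nonneg (∑ ℓ ∈ Finset.range (s ^ (b - a)), eneg ((ξ : ℝ) * ℓ / (s : ℝ) ^ b))
  rw [norm_mul, Complex.norm_real, Real.norm_eq_abs, abs_of_pos (by positivity), mul_assoc,
    div_eq_mul_inv (_ / _) (2 : ℝ)]
  refine mul_le_mul_of_nonneg_left ?_ (by positivity)
  have := mul_le_mul_of_nonneg_left hl hn
  linarith

lemma Afun_bound (N s a : ℕ) (ξ k : ℤ) (hs : 3 ≤ s) (hN : 0 < N)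
    (hξ : |(ξ : ℝ) / (s : ℝ) ^ a| ≤ 1 / 2) :
    ‖Afun N s a ξ‖ * (2 * N * |(ξ : ℝ) / (s : ℝ) ^ a|)
      ≤ Real.pi * |(ξ : ℝ) / (s : ℝ) ^ a * N - k| := by
  unfold Afun
  have hN' : (0 : ℝ) < N := by exact_mod_cast hN
  have hg := geom_eneg (ξ : ℝ) ((s : ℝ) ^ a) N
  have hu := norm_eneg_upper ((ξ : ℝ) / (s : ℝ) ^ a * N) k
  have hl := norm_eneg_lower ((ξ : ℝ) / (s : ℝ) ^ a) 0 (by simpa using hξ)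
  have hn := norm_nonneg (∑ ℓ ∈ Finset.range N, eneg ((ξ : ℝ) * ℓ / (s : ℝ) ^ a))
  rw [norm_mul, norm_inv, Complex.norm_natCast]
  have := mul_le_mul_of_nonneg_left hl hn
  rw [Int.cast_zero, sub_zero] at this
  have e : ∀ S t : ℝ, (N : ℝ)⁻¹ * S * (2 * N * t) = S * (4 * t) / 2 := by
    intro S t
    field_simp
    ring
  rw [e]
  linarith

/-- The real-number bookkeeping. `c = |ℭ|`, `A = |𝔄|`, `y = |ξ/q - k|`, `x = |ξ|`. -/
lemma combine (c A y x N q Q sa z : ℝ) (hc : 0 ≤ c) (hc1 : c ≤ 1)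
    (hx : 0 < x) (hq : 0 < q) (hQ : 16 * q < Q) (hsa : 0 ≤ sa)
    (hN : Q < (N + 2) * q) (hC : c * y ≤ sa / q / 2)
    (hA : A * (2 * N * (x / Q)) ≤ Real.pi * z) (hz : z ≤ y + 2 * (x / Q)) :
    c * A ≤ 8 * (sa / x + q / Q) := by
  have hQ0 : 0 < Q := by linarith
  have hNq : Q ≤ 2 * N * q := by nlinarith
  have hN0 : 0 < N := by
    by_contra h
    push Not at h
    nlinarith
  have hp := Real.pi_lt_four
  have hp0 := Real.pi_pos
  have h1 : c * z ≤ sa / q / 2 + 2 * (x / Q) := by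
    have h3 := mul_le_mul_of_nonneg_left hz hc
    have h4 : c * (2 * (x / Q)) ≤ 2 * (x / Q) := mul_le_of_le_one_left (by positivity) hc1
    linarith
  have h2 : c * A * (2 * N * (x / Q)) ≤ 4 * (sa / q / 2 + 2 * (x / Q)) := by
    have h3 := mul_le_mul_of_nonneg_left hA hc
    have h5 : 0 ≤ sa / q / 2 + 2 * (x / Q) := by positivity
    have h4 : Real.pi * (c * z) ≤ Real.pi * (sa / q / 2 + 2 * (x / Q)) :=
      mul_le_mul_of_nonneg_left h1 hp0.le
    nlinarith
  have h6 : 4 * (sa / q / 2 + 2 * (x / Q)) ≤ 8 * (sa / x + q / Q) * (2 * N * (x / Q)) := by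
    have e1 : 8 * (sa / x + q / Q) * (2 * N * (x / Q))
        = (2 * N * q / Q) * (8 * (sa / q + x / Q)) := by
      field_simp
    have h7 : 1 ≤ 2 * N * q / Q := (one_le_div hQ0).2 hNq
    have h8 : 0 ≤ sa / q := by positivity
    have h9 : 0 ≤ x / Q := by positivity
    rw [e1]
    nlinarith
  exact le_of_mul_le_mul_right (h2.trans h6) (by positivity)

lemma norm_Cfun (s a b : ℕ) (ξ : ℤ) (hs : 3 ≤ s) (hab : a < b) : ‖Cfun s a b ξ‖ ≤ 1 := by
  unfold Cfun
  have hr : (0 : ℝ) < s := by exact_mod_cast (by omega : 0 < s)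
  have hs : ‖∑ ℓ ∈ Finset.range (s ^ (b - a)), eneg ((ξ : ℝ) * ℓ / (s : ℝ) ^ b)‖
      ≤ (s : ℝ) ^ (b - a) := by
    calc _ ≤ ∑ ℓ ∈ Finset.range (s ^ (b - a)), (1 : ℝ) :=
          norm_sum_le_of_le _ fun ℓ _ => (norm_eneg _).le
      _ = _ := by simp
  rw [norm_mul, Complex.norm_real, Real.norm_eq_abs, abs_of_pos (by positivity)]
  calc _ ≤ (s : ℝ) ^ a / (s : ℝ) ^ b * (s : ℝ) ^ (b - a) := by gcongr
    _ = 1 := by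
      rw [div_mul_eq_mul_div, ← pow_add, Nat.add_sub_cancel' hab.le, div_self (by positivity)]

/-- Proposition 6.11 (Pramanik–Zhang): there is an absolute constant `C₀ > 0` such
that the two-scale product `𝔊 = (ε₁ 𝔅*₁ + (1−ε₁) ℭ₁) · 𝔄(·; N₂, s₂, a₂)` satisfies
`|𝔊(ξ)| ≤ C₀ (ε₁ + s₁^{a₁}/|ξ| + s₁^{b₁} s₂^{−a₂})` for
`2 s₁^{a₁} ≤ |ξ| < s₁^{b₁/2} s₂^{a₂/2}`. -/
theorem two_scale_product_estimate :
    ∃ C₀ : ℝ, 0 < C₀ ∧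
      ∀ s₁ s₂ a₁ b₁ a₂ b₂ N₂ : ℕ, 3 ≤ s₁ → 3 ≤ s₂ →
        1 ≤ a₁ → a₁ < b₁ → 1 ≤ a₂ → a₂ < b₂ →
        16 * s₁ ^ b₁ < s₂ ^ a₂ → s₁ ^ (3 * b₁) < s₂ ^ a₂ →
        N₂ + 1 = s₂ ^ a₂ / s₁ ^ b₁ →
        ∀ D₁ : Finset ℕ, D₁ ⊆ Finset.range s₁ → 0 ∈ D₁ → s₁ - 1 ∉ D₁ →
        ∀ ε₁ : ℝ, ε₁ ∈ Set.Ioo (0 : ℝ) 1 →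
        ∀ ξ : ℤ, 2 * (s₁ : ℝ) ^ a₁ ≤ |(ξ : ℝ)| →
          |(ξ : ℝ)| < Real.sqrt ((s₁ : ℝ) ^ b₁ * (s₂ : ℝ) ^ a₂) →
          ‖((ε₁ : ℂ) * Bstar s₁ a₁ b₁ D₁ ξ + ((1 - ε₁ : ℝ) : ℂ) * Cfun s₁ a₁ b₁ ξ) *
              Afun N₂ s₂ a₂ ξ‖ ≤
            C₀ * (ε₁ + (s₁ : ℝ) ^ a₁ / |(ξ : ℝ)| + (s₁ : ℝ) ^ b₁ / (s₂ : ℝ) ^ a₂) := by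
  refine ⟨8, by norm_num, ?_⟩
  intro s₁ s₂ a₁ b₁ a₂ b₂ N₂ hs₁ hs₂ _ hab _ _ hQ _ hN D₁ _ hD _ ε₁ hε ξ hξ1 hξ2
  have hs₁' : (0 : ℝ) < s₁ := by exact_mod_cast (by omega : 0 < s₁)
  have hs₂' : (0 : ℝ) < s₂ := by exact_mod_cast (by omega : 0 < s₂)
  have hq : 0 < s₁ ^ b₁ := by positivity
  have hN0 : 0 < N₂ := by
    have : 16 ≤ s₂ ^ a₂ / s₁ ^ b₁ := (Nat.le_div_iff_mul_le hq).2 hQ.le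
    omega
  have hlow : (N₂ + 1) * s₁ ^ b₁ ≤ s₂ ^ a₂ := by
    rw [hN]; exact Nat.div_mul_le_self _ _
  have hup : s₂ ^ a₂ < (N₂ + 2) * s₁ ^ b₁ := by
    have := Nat.lt_div_mul_add (a := s₂ ^ a₂) hq
    rw [← hN] at this
    linarith
  have hA1 := norm_Afun N₂ s₂ a₂ ξ hN0
  have hB1 := norm_Bstar s₁ a₁ b₁ D₁ ξ hab hD
  have hC1 := norm_Cfun s₁ a₁ b₁ ξ hs₁ hab
  have hyk := abs_sub_round ((ξ : ℝ) / (s₁ : ℝ) ^ b₁)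
  have hC2 := Cfun_bound s₁ a₁ b₁ ξ _ hs₁ hab hyk
  have hQr : 16 * (s₁ : ℝ) ^ b₁ < (s₂ : ℝ) ^ a₂ := by exact_mod_cast hQ
  have hlowr : ((N₂ : ℝ) + 1) * (s₁ : ℝ) ^ b₁ ≤ (s₂ : ℝ) ^ a₂ := by exact_mod_cast hlow
  have hupr : (s₂ : ℝ) ^ a₂ < ((N₂ : ℝ) + 2) * (s₁ : ℝ) ^ b₁ := by exact_mod_cast hup
  have hqr : (0 : ℝ) < (s₁ : ℝ) ^ b₁ := by positivity
  have hQ0 : (0 : ℝ) < (s₂ : ℝ) ^ a₂ := by positivity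
  have hsa : (0 : ℝ) < (s₁ : ℝ) ^ a₁ := by positivity
  have hx : 0 < |(ξ : ℝ)| := by linarith
  generalize round ((ξ : ℝ) / (s₁ : ℝ) ^ b₁) = k at *
  have hxQ : |(ξ : ℝ)| ≤ (s₂ : ℝ) ^ a₂ / 2 := by
    refine hξ2.le.trans (Real.sqrt_le_iff.2 ⟨by positivity, ?_⟩)
    nlinarith
  have hA2 := Afun_bound N₂ s₂ a₂ ξ k hs₂ hN0 (by
    rw [abs_div, abs_of_pos hQ0, div_le_iff₀ hQ0]; linarith)
  generalize hqd : (s₁ : ℝ) ^ b₁ = q at *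
  generalize hQd : (s₂ : ℝ) ^ a₂ = Q at *
  have hz : |(ξ : ℝ) / Q * N₂ - k| ≤ |(ξ : ℝ) / q - k| + 2 * (|(ξ : ℝ)| / Q) := by
    have e : (ξ : ℝ) / Q * N₂ - k = ((ξ : ℝ) / q - k) - (Q / q - N₂) * (ξ / Q) := by
      field_simp
      ring
    rw [e]
    refine (abs_sub _ _).trans ?_
    rw [abs_mul, abs_div (ξ : ℝ), abs_of_pos hQ0]
    have h1 : Q / q < N₂ + 2 := (div_lt_iff₀ hqr).2 hupr
    have h2 : (N₂ : ℝ) + 1 ≤ Q / q := (le_div_iff₀ hqr).2 hlowr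
    have h3 : |Q / q - N₂| ≤ 2 := abs_le.2 ⟨by linarith, by linarith⟩
    gcongr
  rw [abs_div (ξ : ℝ), abs_of_pos hQ0] at hA2
  have key := combine _ _ _ _ _ _ _ _ _ (norm_nonneg _) hC1 hx hqr hQr hsa.le hupr hC2 hA2 hz
  obtain ⟨he0, he1⟩ := hε
  rw [add_mul]
  refine (norm_add_le _ _).trans ?_
  rw [norm_mul, norm_mul, norm_mul, norm_mul, Complex.norm_real, Complex.norm_real,
    Real.norm_eq_abs, Real.norm_eq_abs, abs_of_pos he0, abs_of_pos (by linarith), mul_assoc,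
    mul_assoc]
  have k1 : ‖Bstar s₁ a₁ b₁ D₁ ξ‖ * ‖Afun N₂ s₂ a₂ ξ‖ ≤ 1 :=
    mul_le_one₀ hB1 (norm_nonneg _) hA1
  have k2 : (1 - ε₁) * (‖Cfun s₁ a₁ b₁ ξ‖ * ‖Afun N₂ s₂ a₂ ξ‖)
      ≤ ‖Cfun s₁ a₁ b₁ ξ‖ * ‖Afun N₂ s₂ a₂ ξ‖ :=
    mul_le_of_le_one_left (by positivity) (by linarith)
  have k3 := mul_le_mul_of_nonneg_left k1 he0.le
  linarith
end
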